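/- Let c : ℤⁿ×ℤⁿ → ℂⁿ be antisymmetric structure constants c_{ij}^k = -c_{ji}^k, and let A_c be the quotient of T(x₁,...,x_n)⊗ℂ[ℏ] by relations xᵢxⱼ - xⱼxᵢ = ℏ Σ_k c_{ij}^k x_k. If the c_{ij}^k satisfy the Jacobi identity Σ_a (c_{ij}^a c_{ak}^b + c_{jk}^a c_{ai}^b + c_{ki}^a c_{aj}^b) = 0, then the images of the ordered monomials x₁^{m₁}...x_n^{m_n} form a basis of A_c over ℂ[ℏ] (the PBW property). -/

import Mathlib

/- STATEMENT 12: let `c_{ij}^k` be antisymmetric structure constants and `A_c` the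
quotient of `T(x₁,…,xₙ) ⊗ ℂ[ℏ]` by the relations `xᵢxⱼ - xⱼxᵢ = ℏ Σ_k c_{ij}^k x_k`.
If the `c_{ij}^k` satisfy the Jacobi identity, then the images of the ordered monomials
`x₁^{m₁}…xₙ^{m_n}` form a `ℂ[ℏ]`-basis of `A_c` (the PBW property). -/

noncomputable section

variable (n : ℕ) (c : Fin n → Fin n → Fin n → ℂ)

/-- The defining relations `xᵢ xⱼ = xⱼ xᵢ + ℏ Σ_k c_{ij}^k x_k` in the free algebra
over `ℂ[ℏ]` (quotienting by them is quotienting by the corresponding two-sided ideal). -/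
def relc : FreeAlgebra (Polynomial ℂ) (Fin n) → FreeAlgebra (Polynomial ℂ) (Fin n) → Prop :=
  fun a b => ∃ i j : Fin n,
    a = FreeAlgebra.ι (Polynomial ℂ) i * FreeAlgebra.ι (Polynomial ℂ) j ∧
    b = FreeAlgebra.ι (Polynomial ℂ) j * FreeAlgebra.ι (Polynomial ℂ) i +
      (Polynomial.X : Polynomial ℂ) •
        ∑ k : Fin n, Polynomial.C (c i j k) • FreeAlgebra.ι (Polynomial ℂ) k

/-- The algebra `A_c = T(x₁,…,xₙ)⊗ℂ[ℏ] / (xᵢxⱼ - xⱼxᵢ - ℏ Σ_k c_{ij}^k x_k)`. -/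
abbrev Ac := RingQuot (relc n c)

/-- The image in `A_c` of the ordered monomial `x₁^{m₁} ⋯ xₙ^{m_n}`. -/
def acMonomial (m : Fin n → ℕ) : Ac n c :=
  RingQuot.mkAlgHom (Polynomial ℂ) (relc n c)
    (((List.finRange n).map (fun i => (FreeAlgebra.ι (Polynomial ℂ) i) ^ (m i))).prod)

namespace PBWaux

variable {R : Type*} [CommRing R] {n : ℕ}

/-- unit exponent vector -/
def ee (i : Fin n) : Fin n → ℕ := Pi.single i 1

/-- no index smaller than `i` occurs in `m` -/
def low (i : Fin n) (m : Fin n → ℕ) : Prop := ∀ k, k < i → m k = 0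

/-- total degree -/
def deg (m : Fin n → ℕ) : ℕ := ∑ i, m i

lemma deg_add (m : Fin n → ℕ) (i : Fin n) : deg (m + ee i) = deg m + 1 := by
  simp [deg, ee, Finset.sum_add_distrib]

lemma low_add {i j : Fin n} {m : Fin n → ℕ} (h : low j m) (hij : j ≤ i) : low j (m + ee i) := by
  intro k hk
  have : k ≠ i := ne_of_lt (lt_of_lt_of_le hk hij)
  simp [ee, h k hk, this]

lemma exists_low {i : Fin n} {m : Fin n → ℕ} (h : ¬ low i m) :
    ∃ p : Fin n × (Fin n → ℕ), p.1 < i ∧ low p.1 p.2 ∧ m = p.2 + ee p.1 := by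
  classical
  have hne : (Finset.univ.filter (fun k => m k ≠ 0)).Nonempty := by
    simp only [low, not_forall] at h
    obtain ⟨k, hk, hm⟩ := h
    exact ⟨k, by simp [hm]⟩
  set j := (Finset.univ.filter (fun k => m k ≠ 0)).min' hne with hj
  have hmem := Finset.min'_mem _ hne
  rw [← hj] at hmem
  have hmj : m j ≠ 0 := by simpa using hmem
  have hlow : low j m := by
    intro k hk
    by_contra hc
    have := Finset.min'_le (Finset.univ.filter (fun k => m k ≠ 0)) k (by simp [hc])
    exact absurd hk (not_lt.mpr this)
  have hji : j < i := by
    by_contra hc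
    apply h
    intro k hk
    exact hlow k (lt_of_lt_of_le hk (not_lt.mp hc))
  refine ⟨(j, fun k => m k - ee j k), hji, ?_, ?_⟩
  · intro k hk
    simp [hlow k hk]
  · funext k
    by_cases hk : k = j
    · subst hk
      simp [ee]
      omega
    · simp [ee, hk]

lemma low_unique {p q : Fin n × (Fin n → ℕ)} (hp : low p.1 p.2) (hq : low q.1 q.2)
    (h : p.2 + ee p.1 = q.2 + ee q.1) : p = q := by
  have hp' := low_add hp le_rfl
  have hq' := low_add hq le_rfl
  have h1 : p.1 = q.1 := by
    rcases lt_trichotomy p.1 q.1 with hlt | heq | hlt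
    · have := hq' _ hlt
      rw [← h] at this
      simp [ee] at this
    · exact heq
    · have := hp' _ hlt
      rw [h] at this
      simp [ee] at this
  rw [h1] at h
  exact Prod.ext h1 (add_right_cancel h)

/-- the free module on monomials -/
abbrev MM (R : Type*) [CommRing R] (n : ℕ) := (Fin n → ℕ) →₀ R

/-- basis vector -/
def zz (R : Type*) [CommRing R] {n : ℕ} (m : Fin n → ℕ) : MM R n := Finsupp.single m 1

/-- linear extension -/
def ext (v : (Fin n → ℕ) → MM R n) : MM R n →ₗ[R] MM R n := Finsupp.linearCombination R v

@[simp] lemma ext_zz (v : (Fin n → ℕ) → MM R n) (m : Fin n → ℕ) : ext v (zz R m) = v m := by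
  simp [ext, zz]

open Classical in
/-- approximations of the action -/
def act (d : Fin n → Fin n → Fin n → R) : ℕ → Fin n → (MM R n →ₗ[R] MM R n)
  | 0, i => ext (fun m => zz R (m + ee i))
  | N + 1, i => ext (fun m => if h : low i m then zz R (m + ee i) else
      zz R (m + ee i) +
      act d N (exists_low h).choose.1 (act d N i (zz R (exists_low h).choose.2)
        - zz R ((exists_low h).choose.2 + ee i)) +
      ∑ k, d i (exists_low h).choose.1 k • act d N k (zz R (exists_low h).choose.2))

variable (d : Fin n → Fin n → Fin n → R)

lemma act_low (N : ℕ) {i : Fin n} {m : Fin n → ℕ} (h : low i m) :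
    act d N i (zz R m) = zz R (m + ee i) := by
  cases N <;> simp [act, h]

lemma act_succ (N : ℕ) {i j : Fin n} {m : Fin n → ℕ} (hj : j < i) (h : low j m) :
    act d (N + 1) i (zz R (m + ee j)) = zz R (m + ee j + ee i) +
      act d N j (act d N i (zz R m) - zz R (m + ee i)) + ∑ k, d i j k • act d N k (zz R m) := by
  have hn : ¬ low i (m + ee j) := by
    intro hc
    have := hc j hj
    simp [ee] at this
  have hs := (exists_low hn).choose_spec
  have he : (exists_low hn).choose = (j, m) :=
    low_unique hs.2.1 h hs.2.2.symm
  simp only [act, ext_zz, dif_neg hn]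
  rw [he]

/-- degree filtration -/
def FF (R : Type*) [CommRing R] {n : ℕ} (p : ℕ) : Submodule R (MM R n) :=
  Submodule.span R (zz R '' {m | deg m ≤ p})

lemma zz_mem {m : Fin n → ℕ} {p : ℕ} (h : deg m ≤ p) : zz R m ∈ FF R (n := n) p :=
  Submodule.subset_span ⟨m, h, rfl⟩

lemma FF_mono {p q : ℕ} (h : p ≤ q) : FF R (n := n) p ≤ FF R q :=
  Submodule.span_mono (Set.image_mono (fun _ hm => le_trans hm h))

lemma FF_map {p : ℕ} {f : MM R n →ₗ[R] MM R n} {S : Submodule R (MM R n)}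
    (h : ∀ m, deg m ≤ p → f (zz R m) ∈ S) {v : MM R n} (hv : v ∈ FF R p) : f v ∈ S := by
  have : FF R (n := n) p ≤ S.comap f := by
    apply Submodule.span_le.mpr
    rintro _ ⟨m, hm, rfl⟩
    exact h m hm
  exact this hv

lemma FF_eq {P : Type*} [AddCommGroup P] [Module R P] {p : ℕ} {f g : MM R n →ₗ[R] P}
    (h : ∀ m, deg m ≤ p → f (zz R m) = g (zz R m)) {v : MM R n} (hv : v ∈ FF R p) :
    f v = g v := by
  have : FF R (n := n) p ≤ LinearMap.eqLocus f g := by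
    apply Submodule.span_le.mpr
    rintro _ ⟨m, hm, rfl⟩
    exact h m hm
  exact this hv

lemma act_deg (N : ℕ) : ∀ (i : Fin n) (m : Fin n → ℕ), deg m ≤ N →
    act d N i (zz R m) - zz R (m + ee i) ∈ FF R (n := n) (deg m) := by
  induction N with
  | zero => intro i m _; simp [act]
  | succ N ih =>
    intro i m hm
    by_cases h : low i m
    · rw [act_low d _ h]; simp
    · obtain ⟨⟨j, m'⟩, hj, hl, rfl⟩ := exists_low h
      simp only at hj hl hm ⊢
      rw [deg_add] at hm ⊢
      have key : ∀ (i : Fin n) (q : Fin n → ℕ), deg q ≤ deg m' →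
          act d N i (zz R q) ∈ FF R (n := n) (deg m' + 1) := by
        intro i q hq
        have h1 := FF_mono (R := R) (n := n) (show deg q ≤ deg m' + 1 by omega)
          (ih i q (by omega))
        have h2 : zz R (q + ee i) ∈ FF R (n := n) (deg m' + 1) :=
          zz_mem (by rw [deg_add]; omega)
        simpa using add_mem h1 h2
      rw [act_succ d N hj hl, add_assoc, add_sub_cancel_left]
      refine add_mem (FF_map (key j) (ih i m' (by omega))) (Submodule.sum_mem _ ?_)
      intro k _
      exact Submodule.smul_mem _ _ (key k m' le_rfl)

lemma act_stable (N : ℕ) : ∀ (i : Fin n) (m : Fin n → ℕ), deg m ≤ N →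
    act d (N + 1) i (zz R m) = act d N i (zz R m) := by
  induction N with
  | zero =>
    intro i m hm
    by_cases h : low i m
    · rw [act_low d _ h, act_low d _ h]
    · obtain ⟨⟨j, m'⟩, hj, hl, rfl⟩ := exists_low h
      rw [deg_add] at hm
      omega
  | succ N ih =>
    intro i m hm
    by_cases h : low i m
    · rw [act_low d _ h, act_low d _ h]
    · obtain ⟨⟨j, m'⟩, hj, hl, rfl⟩ := exists_low h
      simp only at hj hl hm ⊢
      rw [deg_add] at hm
      rw [act_succ d _ hj hl, act_succ d _ hj hl, ih i m' (by omega)]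
      congr 2
      · exact FF_eq (fun q hq => ih j q (by omega)) (act_deg d N i m' (by omega))
      · funext k
        rw [ih k m' (by omega)]

lemma act_stable' {N : ℕ} (i : Fin n) (m : Fin n → ℕ) (h : deg m ≤ N) :
    act d N i (zz R m) = act d (deg m) i (zz R m) := by
  induction N, h using Nat.le_induction with
  | base => rfl
  | succ N hN ih => rw [act_stable d N i m hN, ih]

/-- the action -/
def XX (i : Fin n) : MM R n →ₗ[R] MM R n := ext (fun m => act d (deg m) i (zz R m))

lemma XX_act {N : ℕ} (i : Fin n) {v : MM R n} (hv : v ∈ FF R N) : XX d i v = act d N i v :=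
  FF_eq (fun m hm => by rw [act_stable' d i m hm, XX, ext_zz]) hv

lemma XX_low {i : Fin n} {m : Fin n → ℕ} (h : low i m) : XX d i (zz R m) = zz R (m + ee i) := by
  rw [XX, ext_zz, act_low d _ h]

lemma XX_deg (i : Fin n) (m : Fin n → ℕ) :
    XX d i (zz R m) - zz R (m + ee i) ∈ FF R (n := n) (deg m) := by
  rw [XX, ext_zz]
  exact act_deg d _ i m le_rfl

/-- the bracket acting -/
def BB (i j : Fin n) : MM R n →ₗ[R] MM R n := ∑ k, d i j k • XX d k

lemma BB_apply (i j : Fin n) (v : MM R n) : BB d i j v = ∑ k, d i j k • XX d k v := by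
  simp [BB, LinearMap.sum_apply]

lemma XX_succ {i j : Fin n} {m : Fin n → ℕ} (hj : j < i) (h : low j m) :
    XX d i (zz R (m + ee j)) = XX d j (XX d i (zz R m)) + BB d i j (zz R m) := by
  have e1 : XX d j (XX d i (zz R m)) =
      XX d j (XX d i (zz R m) - zz R (m + ee i)) + zz R (m + ee j + ee i) := by
    rw [map_sub, XX_low d (low_add h hj.le), add_right_comm m, sub_add_cancel]
  rw [e1, XX_act d j (XX_deg d i m), BB_apply]
  have e2 : XX d i (zz R (m + ee j)) = act d (deg m + 1) i (zz R (m + ee j)) := by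
    rw [XX, ext_zz, deg_add]
  rw [e2, act_succ d _ hj h]
  simp only [XX, ext_zz]
  abel

lemma BB_anti (hanti : ∀ i j k, d i j k = - d j i k)
    (i j : Fin n) (v : MM R n) : BB d i j v = - BB d j i v := by
  simp only [BB_apply, ← Finset.sum_neg_distrib, ← neg_smul]
  exact Finset.sum_congr rfl (fun k _ => by rw [hanti i j k])

/-- commutation relation on a vector -/
def Comm (i j : Fin n) (v : MM R n) : Prop :=
  XX d i (XX d j v) = XX d j (XX d i v) + BB d i j v

lemma Comm.symm (hanti : ∀ i j k, d i j k = - d j i k)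
    {i j : Fin n} {v : MM R n} (h : Comm d i j v) : Comm d j i v := by
  unfold Comm at *
  rw [h, BB_anti d hanti j i]
  abel

lemma Comm.diag (hdiag : ∀ i k, d i i k = 0)
    (i : Fin n) (v : MM R n) : Comm d i i v := by
  simp [Comm, BB_apply, hdiag]

lemma comm_FF {p : ℕ} {i j : Fin n} (h : ∀ m, deg m ≤ p → Comm d i j (zz R m))
    {v : MM R n} (hv : v ∈ FF R p) : Comm d i j v :=
  FF_eq (f := XX d i ∘ₗ XX d j) (g := XX d j ∘ₗ XX d i + BB d i j) h hv

lemma comm_add {i j : Fin n} {v w : MM R n} (hv : Comm d i j v) (hw : Comm d i j w) :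
    Comm d i j (v + w) := by
  unfold Comm at *
  simp only [map_add, hv, hw]
  abel

lemma comm_low_lt {i j : Fin n} {m : Fin n → ℕ} (hj : j < i) (h : low j m) :
    Comm d i j (zz R m) := by
  rw [Comm, XX_low d h, XX_succ d hj h]

lemma comm_low (hanti : ∀ i j k, d i j k = - d j i k)
    (hdiag : ∀ i k, d i i k = 0)
    {i j : Fin n} {m : Fin n → ℕ} (h : low j m) :
    Comm d i j (zz R m) := by
  rcases lt_trichotomy j i with hlt | heq | hlt
  · exact comm_low_lt d hlt h
  · subst heq; exact Comm.diag d hdiag _ _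
  · exact Comm.symm d hanti (comm_low_lt d hlt (fun k hk => h k (hk.trans hlt)))

/-- nested bracket -/
lemma comm_BB {i j k : Fin n} {v : MM R n} (h : ∀ a, Comm d i a v) :
    XX d i (BB d j k v) = BB d j k (XX d i v) + ∑ b, (∑ a, d j k a * d i a b) • XX d b v := by
  have : ∀ a, XX d i (XX d a v) = XX d a (XX d i v) + BB d i a v := h
  simp only [BB_apply, map_sum, map_smul, this, smul_add, Finset.sum_add_distrib, Finset.smul_sum,
    smul_smul, Finset.sum_smul]
  rw [Finset.sum_comm (f := fun a b => (d j k a * d i a b) • XX d b v)]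

lemma jac_smul (hanti : ∀ i j k, d i j k = - d j i k)
    (hjac : ∀ i j k b,
      ∑ a, (d i j a * d a k b + d j k a * d a i b + d k i a * d a j b) = 0)
    (i j k : Fin n) (v : MM R n) :
    ∑ b, (∑ a, d j k a * d i a b) • XX d b v =
    ∑ b, (∑ a, d i k a * d j a b) • XX d b v - ∑ b, (∑ a, d i j a * d k a b) • XX d b v := by
  rw [← Finset.sum_sub_distrib]
  refine Finset.sum_congr rfl (fun b _ => ?_)
  rw [← sub_smul]
  congr 1
  have := hjac i j k b
  rw [← Finset.sum_sub_distrib, ← sub_eq_zero, ← Finset.sum_sub_distrib, ← neg_eq_zero, ← this,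
    ← Finset.sum_neg_distrib]
  refine Finset.sum_congr rfl (fun a _ => ?_)
  rw [hanti a k, hanti a i, hanti a j, hanti k i]
  ring

lemma comm_zz (hanti : ∀ i j k, d i j k = - d j i k)
    (hdiag : ∀ i k, d i i k = 0)
    (hjac : ∀ i j k b,
      ∑ a, (d i j a * d a k b + d j k a * d a i b + d k i a * d a j b) = 0)
    (N : ℕ) : ∀ (m : Fin n → ℕ), deg m < N → ∀ i j, Comm d i j (zz R m) := by
  induction N with
  | zero => intro m hm; omega
  | succ N ih =>
    intro m hm i j
    by_cases hi : low i m
    · exact Comm.symm d hanti (comm_low d hanti hdiag hi)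
    by_cases hj : low j m
    · exact comm_low d hanti hdiag hj
    obtain ⟨⟨k, m'⟩, hki, hl, rfl⟩ := exists_low hi
    obtain ⟨⟨k', m''⟩, hkj, hl', he⟩ := exists_low hj
    have := low_unique (p := (k, m')) (q := (k', m'')) hl hl' he
    obtain ⟨rfl, rfl⟩ := Prod.mk.inj this
    simp only at hki hkj hl hm ⊢
    rw [deg_add] at hm
    have ih' : ∀ a b, Comm d a b (zz R m') := ih m' (by omega)
    have main : ∀ i j : Fin n, k < i → k < j → XX d i (XX d j (zz R (m' + ee k))) =
        XX d k (XX d i (XX d j (zz R m'))) + BB d i k (XX d j (zz R m')) +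
        BB d j k (XX d i (zz R m')) + ∑ b, (∑ a, d j k a * d i a b) • XX d b (zz R m') := by
      intro i j hki hkj
      have c1 : Comm d i k (XX d j (zz R m')) := by
        have h1 : Comm d i k (zz R (m' + ee j)) := comm_low_lt d hki (low_add hl hkj.le)
        have h2 := comm_FF d (i := i) (j := k) (fun q hq => ih q (by omega) i k) (XX_deg d j m')
        simpa using comm_add d h2 h1
      rw [XX_succ d hkj hl, map_add, c1, comm_BB d (ih' i)]
      abel
    have e3 := comm_BB d (j := i) (k := j) (ih' k)
    have e4 : BB d i j (zz R (m' + ee k)) = BB d i j (XX d k (zz R m')) := by rw [XX_low d hl]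
    rw [Comm, main i j hki hkj, main j i hkj hki, e4, ih' i j, map_add, e3,
      jac_smul d hanti hjac i j k]
    abel

lemma comm_all (hanti : ∀ i j k, d i j k = - d j i k)
    (hdiag : ∀ i k, d i i k = 0)
    (hjac : ∀ i j k b,
      ∑ a, (d i j a * d a k b + d j k a * d a i b + d k i a * d a j b) = 0)
    (i j : Fin n) : XX d i * XX d j = XX d j * XX d i + BB d i j := by
  refine Finsupp.lhom_ext' (fun m => LinearMap.ext_ring ?_)
  exact comm_zz d hanti hdiag hjac (deg m + 1) m (by omega) i j

/-- equivariance of a map from the model to a quotient-like algebra -/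
lemma equivariant {A : Type*} [Ring A] [Algebra R A] (x : Fin n → A)
    (hx : ∀ i j, x i * x j = x j * x i + ∑ k, d i j k • x k)
    (ψ : MM R n →ₗ[R] A) (hψ : ∀ i m, low i m → ψ (zz R (m + ee i)) = x i * ψ (zz R m)) (N : ℕ) :
    ∀ (m : Fin n → ℕ), deg m < N → ∀ i, ψ (XX d i (zz R m)) = x i * ψ (zz R m) := by
  induction N with
  | zero => intro m hm; omega
  | succ N ih =>
    intro m hm i
    by_cases hi : low i m
    · rw [XX_low d hi, hψ i m hi]
    obtain ⟨⟨j, m'⟩, hj, hl, rfl⟩ := exists_low hi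
    simp only at hj hl hm ⊢
    rw [deg_add] at hm
    have h2 : ψ (XX d j (XX d i (zz R m') - zz R (m' + ee i))) =
        x j * ψ (XX d i (zz R m') - zz R (m' + ee i)) :=
      FF_eq (f := ψ ∘ₗ XX d j) (g := LinearMap.mulLeft R (x j) ∘ₗ ψ)
        (fun q hq => ih q (by omega) j) (XX_deg d i m')
    have hl2 := low_add hl hj.le
    have h3 : ψ (XX d j (XX d i (zz R m'))) = x j * (x i * ψ (zz R m')) := by
      rw [map_sub, map_sub, map_sub, mul_sub, XX_low d hl2, hψ j _ hl2, sub_left_inj,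
        ih m' (by omega)] at h2
      exact h2
    rw [XX_succ d hj hl, map_add, h3, hψ j m' hl, ← mul_assoc, ← mul_assoc, hx i j, add_mul, BB_apply,
      map_sum, Finset.sum_mul]
    refine congrArg₂ (· + ·) rfl (Finset.sum_congr rfl (fun k _ => ?_))
    rw [map_smul, ih m' (by omega), smul_mul_assoc]

/-- ordered product over a sorted list -/
lemma list_prod {A : Type*} [Monoid A] (x : Fin n → A) (i : Fin n) (m : Fin n → ℕ) (h : low i m)
    (l : List (Fin n)) (hs : l.Pairwise (· < ·)) (hi : i ∈ l) :
    (l.map (fun k => x k ^ ((m + ee i) k))).prod = x i * (l.map (fun k => x k ^ m k)).prod := by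
  induction l with
  | nil => simp at hi
  | cons a l ih =>
    rw [List.pairwise_cons] at hs
    simp only [List.map_cons, List.prod_cons]
    by_cases hai : i = a
    · subst hai
      have : l.map (fun k => x k ^ ((m + ee i) k)) = l.map (fun k => x k ^ m k) := by
        refine List.map_congr_left (fun k hk => ?_)
        have : k ≠ i := (hs.1 k hk).ne'
        simp [ee, this]
      rw [this]
      simp [ee, pow_succ', mul_assoc]
    · have hil : i ∈ l := by simpa [hai] using hi
      have ha := hs.1 i hil
      rw [ih hs.2 hil]
      have hne : a ≠ i := ha.ne
      simp [ee, h a ha, hne]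

/-- ordered monomial -/
def omon {A : Type*} [Monoid A] (x : Fin n → A) (m : Fin n → ℕ) : A :=
  ((List.finRange n).map (fun k => x k ^ m k)).prod

lemma omon_add {A : Type*} [Monoid A] (x : Fin n → A) (i : Fin n) (m : Fin n → ℕ) (h : low i m) :
    omon x (m + ee i) = x i * omon x m :=
  list_prod x i m h _ (List.pairwise_lt_finRange n) (List.mem_finRange i)

lemma omon_zero {A : Type*} [Monoid A] (x : Fin n → A) : omon x 0 = 1 := by
  simp [omon]

lemma exists_last (m : Fin n → ℕ) (hm : m ≠ 0) :
    ∃ j m', low j m' ∧ m = m' + ee j := by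
  obtain ⟨k, hk⟩ : ∃ k, m k ≠ 0 := by
    by_contra hc
    push Not at hc
    exact hm (funext hc)
  by_cases h : low k m
  · refine ⟨k, fun l => m l - ee k l, ?_, ?_⟩
    · intro l hl
      simp [h l hl]
    · funext l
      by_cases hl : l = k
      · subst hl
        simp [ee]
        omega
      · simp [ee, hl]
  · obtain ⟨⟨j, m'⟩, _, hl, he⟩ := exists_low h
    exact ⟨j, m', hl, he⟩

lemma omon_XX (N : ℕ) : ∀ m : Fin n → ℕ, deg m < N → omon (XX d) m (zz R 0) = zz R m := by
  induction N with
  | zero => intro m hm; omega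
  | succ N ih =>
    intro m hm
    by_cases h0 : m = 0
    · subst h0; simp [omon_zero]
    · obtain ⟨j, m', hl, rfl⟩ := exists_last m h0
      rw [deg_add] at hm
      rw [omon_add _ _ _ hl, Module.End.mul_apply, ih m' (by omega), XX_low d hl]

end PBWaux

open PBWaux

/-- generalized PBW: antisymmetry plus the Jacobi identity for the
structure constants imply that the ordered monomials form a basis of `A_c` over
`ℂ[ℏ]`. -/
theorem stmt12
    (hanti : ∀ i j k, c i j k = - c j i k)
    (hjacobi : ∀ i j k b : Fin n,
      ∑ a : Fin n, (c i j a * c a k b + c j k a * c a i b + c k i a * c a j b) = 0) :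
    LinearIndependent (Polynomial ℂ) (acMonomial n c) ∧
    Submodule.span (Polynomial ℂ) (Set.range (acMonomial n c)) = ⊤ := by
  classical
  set d : Fin n → Fin n → Fin n → Polynomial ℂ := fun i j k => Polynomial.X * Polynomial.C (c i j k)
    with hd
  have danti : ∀ i j k, d i j k = - d j i k := by
    intro i j k
    simp only [hd]
    rw [hanti i j k]
    simp
  have ddiag : ∀ i k, d i i k = 0 := by
    intro i k
    have : c i i k = 0 := self_eq_neg.mp (hanti i i k)
    simp [hd, this]
  have djac : ∀ i j k b,
      ∑ a, (d i j a * d a k b + d j k a * d a i b + d k i a * d a j b) = 0 := by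
    intro i j k b
    have h := congrArg (fun t => Polynomial.X * Polynomial.X * Polynomial.C t) (hjacobi i j k b)
    simp only [map_sum, Finset.mul_sum, map_zero, mul_zero] at h
    rw [← h]
    refine Finset.sum_congr rfl (fun a _ => ?_)
    simp only [hd, Polynomial.C_add, Polynomial.C_mul]
    ring
  let x : Fin n → Ac n c := fun i =>
    RingQuot.mkAlgHom (Polynomial ℂ) (relc n c) (FreeAlgebra.ι (Polynomial ℂ) i)
  have hmon : ∀ m, acMonomial n c m = omon x m := by
    intro m
    simp only [acMonomial, omon, map_list_prod, List.map_map, x]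
    congr 2
    funext i
    simp
  have hx : ∀ i j, x i * x j = x j * x i + ∑ k, d i j k • x k := by
    intro i j
    have := RingQuot.mkAlgHom_rel (Polynomial ℂ) (s := relc n c) ⟨i, j, rfl, rfl⟩
    simp only [map_mul, map_add, map_smul, map_sum, Finset.smul_sum, smul_smul] at this
    exact this
  constructor
  · let f : FreeAlgebra (Polynomial ℂ) (Fin n) →ₐ[Polynomial ℂ]
        Module.End (Polynomial ℂ) (MM (Polynomial ℂ) n) := FreeAlgebra.lift _ (XX d)
    have hf : ∀ ⦃a b⦄, relc n c a b → f a = f b := by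
      rintro _ _ ⟨i, j, rfl, rfl⟩
      simp only [f, map_mul, map_add, map_smul, map_sum, FreeAlgebra.lift_ι_apply]
      rw [comm_all d danti ddiag djac i j]
      simp only [BB, Finset.smul_sum, smul_smul, hd]
    let g := RingQuot.liftAlgHom (Polynomial ℂ) ⟨f, hf⟩
    have hg : ∀ i, g (x i) = XX d i := by
      intro i
      simp only [g, x, RingQuot.liftAlgHom_mkAlgHom_apply, f, FreeAlgebra.lift_ι_apply]
    let φ : Ac n c →ₗ[Polynomial ℂ] MM (Polynomial ℂ) n :=
      (LinearMap.applyₗ (zz (Polynomial ℂ) (0 : Fin n → ℕ)) :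
        Module.End (Polynomial ℂ) (MM (Polynomial ℂ) n) →ₗ[Polynomial ℂ] MM (Polynomial ℂ) n) ∘ₗ
        g.toLinearMap
    have hφ : ∀ m, φ (acMonomial n c m) = zz (Polynomial ℂ) m := by
      intro m
      have : g (acMonomial n c m) = omon (XX d) m := by
        rw [hmon]
        simp only [omon, map_list_prod, List.map_map]
        congr 2
        funext i
        simp [hg]
      change g (acMonomial n c m) (zz (Polynomial ℂ) 0) = _
      rw [this]
      exact omon_XX d (deg m + 1) m (by omega)
    apply LinearIndependent.of_comp φ
    have : φ ∘ acMonomial n c = fun m => Finsupp.single m (1 : Polynomial ℂ) := funext hφ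
    rw [this]
    exact (Finsupp.basisSingleOne (R := Polynomial ℂ) (ι := Fin n → ℕ)).linearIndependent
  · let ψ : MM (Polynomial ℂ) n →ₗ[Polynomial ℂ] Ac n c :=
      Finsupp.linearCombination (Polynomial ℂ) (acMonomial n c)
    have hψz : ∀ m, ψ (zz (Polynomial ℂ) m) = omon x m := by
      intro m
      simp [ψ, zz, hmon]
    have hψ : ∀ i m, ψ (XX d i (zz (Polynomial ℂ) m)) = x i * ψ (zz (Polynomial ℂ) m) := by
      intro i m
      refine equivariant d x hx ψ ?_ (deg m + 1) m (by omega) i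
      intro i m h
      rw [hψz, hψz, omon_add x i m h]
    have hψ' : ∀ i v, ψ (XX d i v) = x i * ψ v := by
      intro i v
      have : ψ ∘ₗ XX d i = LinearMap.mulLeft (Polynomial ℂ) (x i) ∘ₗ ψ :=
        Finsupp.lhom_ext' (fun m => LinearMap.ext_ring (hψ i m))
      exact LinearMap.congr_fun this v
    rw [← Finsupp.range_linearCombination, eq_top_iff]
    have key : ∀ (a : FreeAlgebra (Polynomial ℂ) (Fin n)) (v : MM (Polynomial ℂ) n),
        RingQuot.mkAlgHom (Polynomial ℂ) (relc n c) a * ψ v ∈ LinearMap.range ψ := by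
      intro a
      induction a using FreeAlgebra.induction with
      | grade0 r =>
        intro v
        refine ⟨r • v, ?_⟩
        rw [map_smul, AlgHom.commutes, Algebra.smul_def]
      | grade1 i =>
        intro v
        exact ⟨XX d i v, hψ' i v⟩
      | mul a b ha hb =>
        intro v
        obtain ⟨w, hw⟩ := hb v
        rw [map_mul, mul_assoc, ← hw]
        exact ha w
      | add a b ha hb =>
        intro v
        rw [map_add, add_mul]
        exact add_mem (ha v) (hb v)
    intro y _
    obtain ⟨a, rfl⟩ := RingQuot.mkAlgHom_surjective (Polynomial ℂ) (relc n c) y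
    have := key a (zz (Polynomial ℂ) 0)
    rwa [hψz, omon_zero, mul_one] at this

end
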